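/- arXiv:2205.11000 — 2 statements merged into one kernel-verified Lean document; each statement's English description precedes it below -/
import Mathlib

section
/- For every f ∈ W, Af is twice partially differentiable with respect to both T and x on D, and the second-order partial derivatives (Af)_{TT}, (Af)_{Tx} = (Af)_{xT} and (Af)_{xx} are all continuous on D, so that Af ∈ C²(D). -/
open Set MeasureTheory Filter Topology

noncomputable section

/-- The context of the BCS-Bogoliubov model: the cutoff `eps`, the Debye energy `om = ℏω_D`,
the potential `U` with bounds `U₁ ≤ U ≤ U₂`, the constant `a`, the temperatures
`tau₁, tau₂, T₀, Tc`, the solutions `Δ₁, Δ₂` of the constant-potential gap equations,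
the constant `Mz = max_{z ≥ 0} z / cosh z` and the constant `MT = M_T`. -/
structure BCSContext where
  eps : ℝ
  om : ℝ
  U : ℝ → ℝ → ℝ
  U₁ : ℝ
  U₂ : ℝ
  Umax : ℝ
  Umin : ℝ
  a : ℝ
  tau₁ : ℝ
  tau₂ : ℝ
  Δ₁ : ℝ → ℝ
  Δ₂ : ℝ → ℝ
  Tc : ℝ
  T₀ : ℝ
  Mz : ℝ
  MT : ℝ
  heps : 0 < eps
  hepsom : eps < om
  hU₁pos : 0 < U₁
  hU₁₂ : U₁ ≤ U₂
  hUsmooth : ContDiffOn ℝ 2 (fun p : ℝ × ℝ => U p.1 p.2) (Icc eps om ×ˢ Icc eps om)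
  hUlb : ∀ x ∈ Icc eps om, ∀ ξ ∈ Icc eps om, U₁ ≤ U x ξ
  hUub : ∀ x ∈ Icc eps om, ∀ ξ ∈ Icc eps om, U x ξ ≤ U₂
  hUmax : IsGreatest (Set.image2 U (Icc eps om) (Icc eps om)) Umax
  hUmin : IsLeast (Set.image2 U (Icc eps om) (Icc eps om)) Umin
  ha : a = (Umax / Umin) ^ 2
  htau₁pos : 0 < tau₁
  htau₂pos : 0 < tau₂
  htau₁ : 1 = U₁ * (∫ ξ in eps..om, Real.tanh (ξ / (2 * tau₁)) / ξ)
  htau₂ : 1 = U₂ * (∫ ξ in eps..om, Real.tanh (ξ / (2 * tau₂)) / ξ)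
  hΔ₁nonneg : ∀ T, 0 ≤ Δ₁ T
  hΔ₂nonneg : ∀ T, 0 ≤ Δ₂ T
  hΔ₁cont : Continuous Δ₁
  hΔ₂cont : Continuous Δ₂
  hΔ₁anti : StrictAntiOn Δ₁ (Icc 0 tau₁)
  hΔ₂anti : StrictAntiOn Δ₂ (Icc 0 tau₂)
  hΔ₁eq : ∀ T ∈ Ioc 0 tau₁, U₁ * (∫ ξ in eps..om,
      Real.tanh (Real.sqrt (ξ ^ 2 + Δ₁ T ^ 2) / (2 * T)) / Real.sqrt (ξ ^ 2 + Δ₁ T ^ 2)) = 1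
  hΔ₂eq : ∀ T ∈ Ioc 0 tau₂, U₂ * (∫ ξ in eps..om,
      Real.tanh (Real.sqrt (ξ ^ 2 + Δ₂ T ^ 2) / (2 * T)) / Real.sqrt (ξ ^ 2 + Δ₂ T ^ 2)) = 1
  hΔ₁zero : ∀ T, tau₁ ≤ T → Δ₁ T = 0
  hΔ₂zero : ∀ T, tau₂ ≤ T → Δ₂ T = 0
  hTc₁ : tau₁ ≤ Tc
  hTc₂ : Tc ≤ tau₂
  hT₀₁ : tau₁ < T₀
  hT₀₂ : T₀ < Tc
  hMz : IsGreatest ((fun z => z / Real.cosh z) '' Set.Ici (0 : ℝ)) Mz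
  hMT : MT = 4 * a * U₂ * Mz ^ 2 /
      (eps * U₁ *
        (Real.tanh (eps / (2 * Tc)) - (eps / (2 * Tc)) / Real.cosh (eps / (2 * Tc)) ^ 2) *
        (∫ ξ in eps..om, (ξ ^ 2 + Δ₂ 0 ^ 2) ^ (-(3 : ℝ) / 2)))

namespace BCSContext

/-- The energy interval `I = [ε, ℏω_D]`. -/
def Iset (C : BCSContext) : Set ℝ := Icc C.eps C.om

/-- The rectangle `D = [T₀, T_c] × I`. -/
def Dset (C : BCSContext) : Set (ℝ × ℝ) := Icc C.T₀ C.Tc ×ˢ Icc C.eps C.om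

end BCSContext

/-- The operator `A` of the squared BCS-Bogoliubov gap equation. -/
def opA (C : BCSContext) (f : ℝ → ℝ → ℝ) (T x : ℝ) : ℝ :=
  (∫ ξ in C.eps..C.om, C.U x ξ * Real.sqrt (f T ξ / (ξ ^ 2 + f T ξ)) *
      Real.tanh (Real.sqrt (ξ ^ 2 + f T ξ) / (2 * T))) ^ 2

/-- Partial derivative with respect to the temperature `T` (within `[T₀, T_c]`). -/
def pderivT (C : BCSContext) (g : ℝ → ℝ → ℝ) (T x : ℝ) : ℝ :=
  derivWithin (fun s => g s x) (Icc C.T₀ C.Tc) T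

/-- Partial derivative with respect to the energy `x` (within `I = [ε, ℏω_D]`). -/
def pderivX (C : BCSContext) (g : ℝ → ℝ → ℝ) (T x : ℝ) : ℝ :=
  derivWithin (fun y => g T y) (Icc C.eps C.om) x

/-- Membership in the set `W`. -/
def memW (C : BCSContext) (f : ℝ → ℝ → ℝ) : Prop :=
  ContDiffOn ℝ 2 (fun p : ℝ × ℝ => f p.1 p.2) C.Dset ∧
  (∀ T ∈ Icc C.T₀ C.Tc, ∀ x ∈ C.Iset, C.Δ₁ T ^ 2 ≤ f T x ∧ f T x ≤ C.Δ₂ T ^ 2) ∧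
  (∀ x ∈ C.Iset, f C.Tc x = 0) ∧
  (∀ T ∈ Ico C.T₀ C.Tc, ∀ x ∈ C.Iset, ∀ x₁ ∈ C.Iset, f T x ≤ C.a * f T x₁) ∧
  (∀ x ∈ C.Iset, ∀ x₁ ∈ C.Iset,
      -(pderivT C f C.Tc x) ≤ C.a * -(pderivT C f C.Tc x₁)) ∧
  (∀ T ∈ Icc C.T₀ C.Tc, ∀ x ∈ C.Iset, pderivT C f T x < 0) ∧
  (∀ T ∈ Icc C.T₀ C.Tc, ∀ x ∈ C.Iset, -(pderivT C f T x) ≤ C.MT)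

/-- The condition `a^{1/4} · max_{(T,x) ∈ D} ∫_I (U(x,ξ)/ξ) tanh(ξ/(2T)) dξ ≤ 1`. -/
def gapCondition (C : BCSContext) : Prop :=
  ∀ T ∈ Icc C.T₀ C.Tc, ∀ x ∈ C.Iset,
    C.a ^ ((1 : ℝ) / 4) * (∫ ξ in C.eps..C.om, C.U x ξ / ξ * Real.tanh (ξ / (2 * T))) ≤ 1

instance (C : BCSContext) : CompactSpace ↥C.Dset :=
  isCompact_iff_compactSpace.mp (isCompact_Icc.prod isCompact_Icc)

-- Extension of a continuous function on `D` to a function on `ℝ × ℝ` (by `0` outside `D`).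
open Classical in
def extFun (C : BCSContext) (F : C(↥C.Dset, ℝ)) : ℝ → ℝ → ℝ :=
  fun T x => if h : (T, x) ∈ C.Dset then F ⟨(T, x), h⟩ else 0

/-- The set `W` regarded as a subset of the Banach space `C(D)`. -/
def WSet (C : BCSContext) : Set C(↥C.Dset, ℝ) :=
  {F | ∃ f : ℝ → ℝ → ℝ, memW C f ∧ ∀ p : ↥C.Dset, F p = f (p : ℝ × ℝ).1 (p : ℝ × ℝ).2}

/-! ### Integrals depending on a parameter in a compact set -/

section ParametricIntegral

variable {E G : Type*} [NormedAddCommGroup E] [NormedAddCommGroup G]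

/-- Joint continuity on `P ×ˢ [a, b]` gives integrability of each slice. -/
lemma intervalIntegrable_slice_of_continuousOn {P : Set E} {a b : ℝ} (hab : a ≤ b)
    {F : E → ℝ → G} (hF : ContinuousOn (fun q : E × ℝ => F q.1 q.2) (P ×ˢ Icc a b))
    {p : E} (hp : p ∈ P) : IntervalIntegrable (F p) volume a b := by
  refine ContinuousOn.intervalIntegrable_of_Icc hab ?_
  exact hF.comp (f := fun u : ℝ => (p, u)) (by fun_prop) (fun u hu => ⟨hp, hu⟩)

/-- Joint continuity on a compact product gives continuity in the parameter, uniformly in the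
integration variable. -/
lemma exists_forall_norm_sub_le_of_continuousOn_prod {P : Set E} (hP : IsCompact P) {a b : ℝ}
    {F : E → ℝ → G} (hF : ContinuousOn (fun q : E × ℝ => F q.1 q.2) (P ×ˢ Icc a b))
    {e : ℝ} (he : 0 < e) :
    ∃ d > 0, ∀ p ∈ P, ∀ q ∈ P, dist p q < d → ∀ u ∈ Icc a b, ‖F p u - F q u‖ ≤ e := by
  have huc := (hP.prod isCompact_Icc).uniformContinuousOn_of_continuous hF
  rw [Metric.uniformContinuousOn_iff] at huc
  obtain ⟨d, hd, h⟩ := huc e he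
  refine ⟨d, hd, fun p hp q hq hpq u hu => ?_⟩
  have := h (p, u) ⟨hp, hu⟩ (q, u) ⟨hq, hu⟩ (by simpa [Prod.dist_eq, hd] using hpq)
  rw [dist_eq_norm] at this
  exact this.le

lemma continuousOn_intervalIntegral_of_continuousOn_prod [NormedSpace ℝ G] {P : Set E}
    (hP : IsCompact P) {a b : ℝ} (hab : a ≤ b) {F : E → ℝ → G}
    (hF : ContinuousOn (fun q : E × ℝ => F q.1 q.2) (P ×ˢ Icc a b)) :
    ContinuousOn (fun p => ∫ u in a..b, F p u) P := by
  rw [Metric.continuousOn_iff]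
  intro p hp e he
  have hb : 0 < b - a + 1 := by linarith
  obtain ⟨d, hd, h⟩ := exists_forall_norm_sub_le_of_continuousOn_prod hP hF (div_pos he hb)
  refine ⟨d, hd, fun q hq hqp => ?_⟩
  rw [dist_eq_norm, ← intervalIntegral.integral_sub
    (intervalIntegrable_slice_of_continuousOn hab hF hq)
    (intervalIntegrable_slice_of_continuousOn hab hF hp)]
  have := intervalIntegral.norm_integral_le_of_norm_le_const (a := a) (b := b)
    (f := fun u => F q u - F p u) (C := e / (b - a + 1)) (fun u hu => by
      rw [uIoc_of_le hab] at hu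
      exact h q hq p hp hqp u ⟨hu.1.le, hu.2⟩)
  refine this.trans_lt ?_
  rw [abs_of_nonneg (by linarith), div_mul_eq_mul_div, div_lt_iff₀ hb]
  nlinarith

/-- Differentiation under the integral sign, within a compact convex set of parameters. -/
lemma hasFDerivWithinAt_intervalIntegral_of_continuousOn_prod [NormedSpace ℝ E]
    [NormedSpace ℝ G] [CompleteSpace G] {P : Set E}
    (hP : IsCompact P) (hconv : Convex ℝ P) {a b : ℝ} (hab : a ≤ b)
    {F : E → ℝ → G} {F' : E → ℝ → E →L[ℝ] G}
    (hF : ContinuousOn (fun q : E × ℝ => F q.1 q.2) (P ×ˢ Icc a b))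
    (hF' : ContinuousOn (fun q : E × ℝ => F' q.1 q.2) (P ×ˢ Icc a b))
    (hd : ∀ p ∈ P, ∀ u ∈ Icc a b, HasFDerivWithinAt (fun q => F q u) (F' p u) P p)
    {p : E} (hp : p ∈ P) :
    HasFDerivWithinAt (fun q => ∫ u in a..b, F q u) (∫ u in a..b, F' p u) P p := by
  rw [hasFDerivWithinAt_iff_isLittleO, Asymptotics.isLittleO_iff]
  intro c hc
  have hb : 0 < b - a + 1 := by linarith
  obtain ⟨d, hd0, h⟩ := exists_forall_norm_sub_le_of_continuousOn_prod hP hF' (div_pos hc hb)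
  filter_upwards [inter_mem_nhdsWithin P (Metric.ball_mem_nhds p hd0)] with q hq
  have hiF : ∀ r ∈ P, IntervalIntegrable (F r) volume a b :=
    fun r hr => intervalIntegrable_slice_of_continuousOn hab hF hr
  have hiF' := intervalIntegrable_slice_of_continuousOn hab hF' hp
  rw [ContinuousLinearMap.intervalIntegral_apply hiF',
    ← intervalIntegral.integral_sub (hiF q hq.1) (hiF p hp),
    ← intervalIntegral.integral_sub ((hiF q hq.1).sub (hiF p hp))
      (intervalIntegrable_slice_of_continuousOn hab (F := fun r u => F' r u (q - p))
        (hF'.clm_apply continuousOn_const) hp)]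
  have := intervalIntegral.norm_integral_le_of_norm_le_const (a := a) (b := b)
    (f := fun u => F q u - F p u - F' p u (q - p)) (C := c / (b - a + 1) * ‖q - p‖)
    (fun u hu => by
      rw [uIoc_of_le hab] at hu
      have hu' : u ∈ Icc a b := ⟨hu.1.le, hu.2⟩
      refine Convex.norm_image_sub_le_of_norm_hasFDerivWithin_le' (𝕜 := ℝ)
        (s := P ∩ Metric.ball p d) (f := fun q => F q u) (f' := fun q => F' q u)
        (fun x hx => (hd x hx.1 u hu').mono inter_subset_left)
        (fun x hx => h x hx.1 p hp hx.2 u hu')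
        (hconv.inter (convex_ball p d)) ⟨hp, Metric.mem_ball_self hd0⟩ hq)
  refine this.trans ?_
  rw [abs_of_nonneg (by linarith)]
  have h1 : c / (b - a + 1) * (b - a) ≤ c := by
    rw [div_mul_eq_mul_div, div_le_iff₀ hb]
    nlinarith
  nlinarith [norm_nonneg (q - p)]

end ParametricIntegral

/-! ### Functions with a continuous partial derivative in the first variable -/

/-- On `J ×ˢ I`, the function `g` is continuous and has the continuous function `g₁` as its partial
derivative with respect to the first variable. -/
structure HasContPartialFst (J I : Set ℝ) (g g₁ : ℝ × ℝ → ℝ) : Prop where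
  cont : ContinuousOn g (J ×ˢ I)
  cont_partial : ContinuousOn g₁ (J ×ˢ I)
  hasDeriv : ∀ t ∈ J, ∀ x ∈ I, HasDerivWithinAt (fun s => g (s, x)) (g₁ (t, x)) J t

namespace HasContPartialFst

variable {J I : Set ℝ} {g g₁ k k₁ : ℝ × ℝ → ℝ}

lemma add (hg : HasContPartialFst J I g g₁) (hk : HasContPartialFst J I k k₁) :
    HasContPartialFst J I (fun p => g p + k p) (fun p => g₁ p + k₁ p) :=
  ⟨hg.cont.add hk.cont, hg.cont_partial.add hk.cont_partial,
    fun t ht x hx => (hg.hasDeriv t ht x hx).add (hk.hasDeriv t ht x hx)⟩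

lemma mul (hg : HasContPartialFst J I g g₁) (hk : HasContPartialFst J I k k₁) :
    HasContPartialFst J I (fun p => g p * k p) (fun p => g₁ p * k p + g p * k₁ p) :=
  ⟨hg.cont.mul hk.cont, (hg.cont_partial.mul hk.cont).add (hg.cont.mul hk.cont_partial),
    fun t ht x hx => (hg.hasDeriv t ht x hx).mul (hk.hasDeriv t ht x hx)⟩

lemma sqrt (hg : HasContPartialFst J I g g₁) (hpos : ∀ p ∈ J ×ˢ I, 0 < g p) :
    HasContPartialFst J I (fun p => √(g p)) (fun p => g₁ p / (2 * √(g p))) :=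
  ⟨hg.cont.sqrt, hg.cont_partial.div (by have := hg.cont.sqrt; fun_prop)
      (fun p hp => by have := Real.sqrt_pos.2 (hpos p hp); positivity),
    fun t ht x hx => (hg.hasDeriv t ht x hx).sqrt (hpos (t, x) ⟨ht, hx⟩).ne'⟩

lemma inv (hg : HasContPartialFst J I g g₁) (hne : ∀ p ∈ J ×ˢ I, g p ≠ 0) :
    HasContPartialFst J I (fun p => (g p)⁻¹) (fun p => -g₁ p / g p ^ 2) :=
  ⟨hg.cont.inv₀ hne, hg.cont_partial.neg.div (hg.cont.pow 2) (fun p hp => pow_ne_zero 2 (hne p hp)),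
    fun t ht x hx => (hg.hasDeriv t ht x hx).inv (hne (t, x) ⟨ht, hx⟩)⟩

lemma const_sub_fst (b : ℝ) : HasContPartialFst J I (fun p => b - p.1) (fun _ => -1) :=
  ⟨by fun_prop, by fun_prop, fun t _ _ _ => (hasDerivWithinAt_id t J).const_sub b⟩

end HasContPartialFst

lemma hasDerivWithinAt_slice_fst {G : ℝ × ℝ → ℝ} {L : ℝ × ℝ →L[ℝ] ℝ} {J I : Set ℝ} {t x : ℝ}
    (hx : x ∈ I) (h : HasFDerivWithinAt G L (J ×ˢ I) (t, x)) :
    HasDerivWithinAt (fun s => G (s, x)) (L (1, 0)) J t :=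
  h.comp_hasDerivWithinAt t ((hasDerivWithinAt_id t J).prodMk (hasDerivWithinAt_const t J x))
    (fun _ hs => mk_mem_prod hs hx)

lemma hasDerivWithinAt_slice_snd {G : ℝ × ℝ → ℝ} {L : ℝ × ℝ →L[ℝ] ℝ} {J I : Set ℝ} {t x : ℝ}
    (ht : t ∈ J) (h : HasFDerivWithinAt G L (J ×ˢ I) (t, x)) :
    HasDerivWithinAt (fun y => G (t, y)) (L (0, 1)) I x :=
  h.comp_hasDerivWithinAt x ((hasDerivWithinAt_const x I t).prodMk (hasDerivWithinAt_id x I))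
    (fun _ hs => ⟨ht, hs⟩)

lemma exists_hasContPartialFst_of_contDiffOn {J I : Set ℝ} (hu : UniqueDiffOn ℝ (J ×ˢ I))
    {g : ℝ × ℝ → ℝ} (hg : ContDiffOn ℝ 2 g (J ×ˢ I)) :
    ∃ g₁ g₂, HasContPartialFst J I g g₁ ∧ HasContPartialFst J I g₁ g₂ := by
  have key : ∀ k : ℝ × ℝ → ℝ, ContDiffOn ℝ 1 k (J ×ˢ I) →
      HasContPartialFst J I k (fun p => fderivWithin ℝ k (J ×ˢ I) p (1, 0)) := fun k hk =>
    ⟨hk.continuousOn, (hk.continuousOn_fderivWithin hu le_rfl).clm_apply continuousOn_const,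
      fun t ht x hx => hasDerivWithinAt_slice_fst hx
        ((hk.differentiableOn one_ne_zero (t, x) ⟨ht, hx⟩).hasFDerivWithinAt)⟩
  refine ⟨_, _, key g (hg.of_le one_le_two), key _ ?_⟩
  exact (hg.fderivWithin hu (m := 1) (by norm_num)).clm_apply contDiffOn_const

/-- Hadamard's lemma: a function which vanishes at the right end point of the interval is
the product of `b - t` and of a function with a continuous partial derivative. -/
lemma HasContPartialFst.exists_eq_sub_mul {a b : ℝ} (hab : a < b) {I : Set ℝ} (hI : IsCompact I)
    {f f₁ f₂ : ℝ × ℝ → ℝ} (hf : HasContPartialFst (Icc a b) I f f₁)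
    (hf₁ : HasContPartialFst (Icc a b) I f₁ f₂) (hzero : ∀ x ∈ I, f (b, x) = 0)
    (hneg : ∀ p ∈ Icc a b ×ˢ I, f₁ p < 0) :
    ∃ h h₁, HasContPartialFst (Icc a b) I h h₁ ∧
      (∀ p ∈ Icc a b ×ˢ I, f p = (b - p.1) * h p) ∧ (∀ p ∈ Icc a b ×ˢ I, 0 < h p) ∧
      (∀ p ∈ Icc a b ×ˢ I, (b - p.1) * h₁ p = f₁ p + h p) := by
  have hmaps : ∀ t ∈ Icc a b, ∀ u ∈ Icc (0 : ℝ) 1, t + u * (b - t) ∈ Icc a b := by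
    intro t ht u hu
    constructor
    · nlinarith [ht.1, ht.2, hu.1, hu.2]
    · nlinarith [ht.1, ht.2, hu.1, hu.2]
  have hmaps' : MapsTo (fun q : (ℝ × ℝ) × ℝ => (q.1.1 + q.2 * (b - q.1.1), q.1.2))
      ((Icc a b ×ˢ I) ×ˢ Icc (0 : ℝ) 1) (Icc a b ×ˢ I) :=
    fun q hq => ⟨hmaps _ hq.1.1 _ hq.2, hq.1.2⟩
  have hc : ContinuousOn (fun q : (ℝ × ℝ) × ℝ => -f₁ (q.1.1 + q.2 * (b - q.1.1), q.1.2))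
      ((Icc a b ×ˢ I) ×ˢ Icc (0 : ℝ) 1) := (hf₁.cont.comp (by fun_prop) hmaps').neg
  have hc' : ContinuousOn
      (fun q : (ℝ × ℝ) × ℝ => -(f₂ (q.1.1 + q.2 * (b - q.1.1), q.1.2) * (1 - q.2)))
      ((Icc a b ×ˢ I) ×ˢ Icc (0 : ℝ) 1) :=
    ((hf₁.cont_partial.comp (by fun_prop) hmaps').mul (by fun_prop)).neg
  set h : ℝ × ℝ → ℝ := fun p => ∫ u in (0 : ℝ)..1, -f₁ (p.1 + u * (b - p.1), p.2) with hh
  set h₁ : ℝ × ℝ → ℝ :=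
    fun p => ∫ u in (0 : ℝ)..1, -(f₂ (p.1 + u * (b - p.1), p.2) * (1 - u)) with hh₁
  have hcomp : IsCompact (Icc a b ×ˢ I) := isCompact_Icc.prod hI
  have H : HasContPartialFst (Icc a b) I h h₁ := by
    refine ⟨continuousOn_intervalIntegral_of_continuousOn_prod hcomp zero_le_one hc,
      continuousOn_intervalIntegral_of_continuousOn_prod hcomp zero_le_one hc', ?_⟩
    intro t ht x hx
    have hemb : MapsTo (fun q : ℝ × ℝ => ((q.1, x), q.2)) (Icc a b ×ˢ Icc (0 : ℝ) 1)
        ((Icc a b ×ˢ I) ×ˢ Icc (0 : ℝ) 1) := fun q hq => ⟨mk_mem_prod hq.1 hx, hq.2⟩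
    have hcx := hc.comp (by fun_prop) hemb
    have hcx' := hc'.comp (by fun_prop) hemb
    have := hasFDerivWithinAt_intervalIntegral_of_continuousOn_prod (P := Icc a b) isCompact_Icc
      (convex_Icc a b) (zero_le_one (α := ℝ))
      (F := fun s u => -f₁ (s + u * (b - s), x))
      (F' := fun s u => (-(f₂ (s + u * (b - s), x) * (1 - u))) •
        (ContinuousLinearMap.id ℝ ℝ)) hcx
      (hcx'.smul continuousOn_const) (fun s hs u hu => by
        have h1 : HasDerivWithinAt (fun s => s + u * (b - s)) (1 - u) (Icc a b) s := by
          have := (hasDerivWithinAt_id s (Icc a b)).add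
            (((hasDerivWithinAt_id s (Icc a b)).const_sub b).const_mul u)
          convert! this using 1
          ring
        have h2 := ((hf₁.hasDeriv _ (hmaps s hs u hu) x hx).comp s h1
          (fun r hr => hmaps r hr u hu)).neg
        rw [hasDerivWithinAt_iff_hasFDerivWithinAt] at h2
        convert! h2 using 1
        ext
        simp) ht
    rw [intervalIntegral.integral_smul_const] at this
    convert! this.hasDerivWithinAt using 1
    simp [hh₁]
  have hfac : ∀ p ∈ Icc a b ×ˢ I, f p = (b - p.1) * h p := by
    rintro ⟨t, x⟩ ⟨ht, hx⟩
    have hg : ∀ u ∈ Icc (0 : ℝ) 1, HasDerivWithinAt (fun u => f (t + u * (b - t), x))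
        (f₁ (t + u * (b - t), x) * (b - t)) (Icc 0 1) u := fun u hu => by
      have h1 : HasDerivWithinAt (fun u => t + u * (b - t)) (b - t) (Icc 0 1) u := by
        simpa using ((hasDerivWithinAt_id u (Icc (0 : ℝ) 1)).mul_const (b - t)).const_add t
      exact (hf.hasDeriv _ (hmaps t ht u hu) x hx).comp u h1 (fun r hr => hmaps t ht r hr)
    have hcu : ContinuousOn (fun u => f₁ (t + u * (b - t), x)) (Icc 0 1) :=
      hf₁.cont.comp (f := fun u => (t + u * (b - t), x)) (by fun_prop)
        (fun u hu => ⟨hmaps t ht u hu, hx⟩)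
    have := intervalIntegral.integral_eq_sub_of_hasDerivAt_of_le (zero_le_one (α := ℝ))
      (fun u hu => (hg u hu).continuousWithinAt)
      (fun u hu => (hg u (Ioo_subset_Icc_self hu)).hasDerivAt (Icc_mem_nhds hu.1 hu.2))
      ((hcu.mul continuousOn_const).intervalIntegrable_of_Icc zero_le_one)
    simp only [one_mul, add_sub_cancel, zero_mul, add_zero, hzero x hx,
      intervalIntegral.integral_mul_const] at this
    simp only [hh, intervalIntegral.integral_neg]
    linarith
  refine ⟨h, h₁, H, hfac, ?_, ?_⟩
  · rintro ⟨t, x⟩ ⟨ht, hx⟩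
    refine intervalIntegral.intervalIntegral_pos_of_pos_on
      (intervalIntegrable_slice_of_continuousOn zero_le_one
        (F := fun (p : ℝ × ℝ) u => -f₁ (p.1 + u * (b - p.1), p.2)) hc
        (p := (t, x)) ⟨ht, hx⟩) (fun u hu => ?_) zero_lt_one
    have := hneg _ (hmaps' (x := ((t, x), u)) ⟨⟨ht, hx⟩, Ioo_subset_Icc_self hu⟩)
    simpa using this
  · rintro ⟨t, x⟩ ⟨ht, hx⟩
    have h1 := ((HasContPartialFst.const_sub_fst (J := Icc a b) (I := I) b).mul H).hasDeriv t ht x hx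
    have h2 : HasDerivWithinAt (fun s => (b - s) * h (s, x)) (f₁ (t, x)) (Icc a b) t :=
      (hf.hasDeriv t ht x hx).congr (fun s hs => (hfac (s, x) ⟨hs, hx⟩).symm)
        (hfac (t, x) ⟨ht, hx⟩).symm
    have h3 := (uniqueDiffOn_Icc hab t ht).eq_deriv _ h1 h2
    simp only at h3
    linarith

/-! ### Integral operators with a kernel -/

/-- The function `(t, x) ↦ ∫ V(x, ξ) g(t, ξ) dξ`. -/
def kernelIntegral (c d : ℝ) (V g : ℝ × ℝ → ℝ) (p : ℝ × ℝ) : ℝ :=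
  ∫ ξ in c..d, V (p.2, ξ) * g (p.1, ξ)

section KernelIntegral

variable {J : Set ℝ} {c d : ℝ} {V V₁ g g₁ : ℝ × ℝ → ℝ}

lemma continuousOn_kernelIntegrand (hV : ContinuousOn V (Icc c d ×ˢ Icc c d))
    (hg : ContinuousOn g (J ×ˢ Icc c d)) :
    ContinuousOn (fun q : (ℝ × ℝ) × ℝ => V (q.1.2, q.2) * g (q.1.1, q.2))
      ((J ×ˢ Icc c d) ×ˢ Icc c d) :=
  (hV.comp (f := fun q : (ℝ × ℝ) × ℝ => (q.1.2, q.2)) (by fun_prop)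
      (fun _ hq => ⟨hq.1.2, hq.2⟩)).mul
    (hg.comp (f := fun q : (ℝ × ℝ) × ℝ => (q.1.1, q.2)) (by fun_prop)
      (fun _ hq => ⟨hq.1.1, hq.2⟩))

lemma continuousOn_kernelIntegral (hJ : IsCompact J) (hcd : c ≤ d)
    (hV : ContinuousOn V (Icc c d ×ˢ Icc c d)) (hg : ContinuousOn g (J ×ˢ Icc c d)) :
    ContinuousOn (kernelIntegral c d V g) (J ×ˢ Icc c d) :=
  continuousOn_intervalIntegral_of_continuousOn_prod (hJ.prod isCompact_Icc) hcd
    (continuousOn_kernelIntegrand hV hg)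

lemma hasFDerivWithinAt_kernelIntegral (hJ : IsCompact J) (hJc : Convex ℝ J) (hcd : c ≤ d)
    (hV : HasContPartialFst (Icc c d) (Icc c d) V V₁) (hg : HasContPartialFst J (Icc c d) g g₁)
    {p : ℝ × ℝ} (hp : p ∈ J ×ˢ Icc c d) :
    HasFDerivWithinAt (kernelIntegral c d V g)
      (kernelIntegral c d V g₁ p • ContinuousLinearMap.fst ℝ ℝ ℝ +
        kernelIntegral c d V₁ g p • ContinuousLinearMap.snd ℝ ℝ ℝ) (J ×ˢ Icc c d) p := by
  have c₁ : ContinuousOn (fun q : (ℝ × ℝ) × ℝ =>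
      (V (q.1.2, q.2) * g₁ (q.1.1, q.2)) • ContinuousLinearMap.fst ℝ ℝ ℝ)
      ((J ×ˢ Icc c d) ×ˢ Icc c d) :=
    (continuousOn_kernelIntegrand hV.cont hg.cont_partial).smul continuousOn_const
  have c₂ : ContinuousOn (fun q : (ℝ × ℝ) × ℝ =>
      (V₁ (q.1.2, q.2) * g (q.1.1, q.2)) • ContinuousLinearMap.snd ℝ ℝ ℝ)
      ((J ×ˢ Icc c d) ×ˢ Icc c d) :=
    (continuousOn_kernelIntegrand hV.cont_partial hg.cont).smul continuousOn_const
  have := hasFDerivWithinAt_intervalIntegral_of_continuousOn_prod (hJ.prod isCompact_Icc)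
    (hJc.prod (convex_Icc c d)) hcd
    (F := fun (p : ℝ × ℝ) ξ => V (p.2, ξ) * g (p.1, ξ))
    (F' := fun (p : ℝ × ℝ) ξ => (V (p.2, ξ) * g₁ (p.1, ξ)) • ContinuousLinearMap.fst ℝ ℝ ℝ +
        (V₁ (p.2, ξ) * g (p.1, ξ)) • ContinuousLinearMap.snd ℝ ℝ ℝ)
    (continuousOn_kernelIntegrand hV.cont hg.cont)
    (c₁.add c₂)
    (fun q hq ξ hξ => by
      have h1 := (hV.hasDeriv q.2 hq.2 ξ hξ).comp_hasFDerivWithinAt q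
        (hasFDerivWithinAt_snd (𝕜 := ℝ) (s := J ×ˢ Icc c d)) (fun r hr => hr.2)
      have h2 := (hg.hasDeriv q.1 hq.1 ξ hξ).comp_hasFDerivWithinAt q
        (hasFDerivWithinAt_fst (𝕜 := ℝ) (s := J ×ˢ Icc c d)) (fun r hr => hr.1)
      convert! h1.mul h2 using 1
      ext
      · simp
      · simp [mul_comm]) hp
  rw [intervalIntegral.integral_add
      (intervalIntegrable_slice_of_continuousOn hcd (F := fun (p : ℝ × ℝ) ξ =>
        (V (p.2, ξ) * g₁ (p.1, ξ)) • ContinuousLinearMap.fst ℝ ℝ ℝ) c₁ hp)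
      (intervalIntegrable_slice_of_continuousOn hcd (F := fun (p : ℝ × ℝ) ξ =>
        (V₁ (p.2, ξ) * g (p.1, ξ)) • ContinuousLinearMap.snd ℝ ℝ ℝ) c₂ hp),
    intervalIntegral.integral_smul_const, intervalIntegral.integral_smul_const] at this
  exact this

lemma contDiffOn_of_hasFDerivWithinAt_prod {s : Set (ℝ × ℝ)} (hu : UniqueDiffOn ℝ s) {n : ℕ}
    {G A B : ℝ × ℝ → ℝ} (hA : ContDiffOn ℝ n A s) (hB : ContDiffOn ℝ n B s)
    (hG : ∀ p ∈ s, HasFDerivWithinAt G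
      (A p • ContinuousLinearMap.fst ℝ ℝ ℝ + B p • ContinuousLinearMap.snd ℝ ℝ ℝ) s p) :
    ContDiffOn ℝ (n + 1) G s := by
  rw [contDiffOn_succ_iff_hasFDerivWithinAt_of_uniqueDiffOn hu]
  exact ⟨by simp, _, (hA.smul contDiffOn_const).add (hB.smul contDiffOn_const), hG⟩

lemma contDiffOn_kernelIntegral (hJ : IsCompact J) (hJc : Convex ℝ J) (hcd : c ≤ d)
    (hu : UniqueDiffOn ℝ (J ×ˢ Icc c d))
    (hV : HasContPartialFst (Icc c d) (Icc c d) V V₁) (hg : HasContPartialFst J (Icc c d) g g₁) :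
    ContDiffOn ℝ 1 (kernelIntegral c d V g) (J ×ˢ Icc c d) := by
  have := contDiffOn_of_hasFDerivWithinAt_prod hu (n := 0)
    (contDiffOn_zero.2 (continuousOn_kernelIntegral hJ hcd hV.cont hg.cont_partial))
    (contDiffOn_zero.2 (continuousOn_kernelIntegral hJ hcd hV.cont_partial hg.cont))
    (fun p hp => hasFDerivWithinAt_kernelIntegral hJ hJc hcd hV hg hp)
  simpa using this

end KernelIntegral

/-! ### Partial derivatives on the rectangle `D` -/

lemma BCSContext.uniqueDiffOn_Dset (C : BCSContext) : UniqueDiffOn ℝ C.Dset :=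
  (uniqueDiffOn_Icc C.hT₀₂).prod (uniqueDiffOn_Icc C.hepsom)

lemma pderivT_eq_of_hasFDerivWithinAt {C : BCSContext} {g : ℝ → ℝ → ℝ} {L : ℝ × ℝ →L[ℝ] ℝ}
    {T x : ℝ} (hT : T ∈ Icc C.T₀ C.Tc) (hx : x ∈ Icc C.eps C.om)
    (h : HasFDerivWithinAt (fun p : ℝ × ℝ => g p.1 p.2) L C.Dset (T, x)) :
    pderivT C g T x = L (1, 0) :=
  (hasDerivWithinAt_slice_fst hx h).derivWithin (uniqueDiffOn_Icc C.hT₀₂ T hT)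

lemma pderivX_eq_of_hasFDerivWithinAt {C : BCSContext} {g : ℝ → ℝ → ℝ} {L : ℝ × ℝ →L[ℝ] ℝ}
    {T x : ℝ} (hT : T ∈ Icc C.T₀ C.Tc) (hx : x ∈ Icc C.eps C.om)
    (h : HasFDerivWithinAt (fun p : ℝ × ℝ => g p.1 p.2) L C.Dset (T, x)) :
    pderivX C g T x = L (0, 1) :=
  (hasDerivWithinAt_slice_snd hT h).derivWithin (uniqueDiffOn_Icc C.hepsom x hx)

/-- A function of class `C²` on `D` has continuous second-order partial derivatives on `D`, and the
mixed ones agree. -/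
lemma secondOrderPartials_of_contDiffOn (C : BCSContext) (g : ℝ → ℝ → ℝ)
    (hg : ContDiffOn ℝ 2 (fun p : ℝ × ℝ => g p.1 p.2) C.Dset) :
    (∀ T ∈ Icc C.T₀ C.Tc, ∀ x ∈ C.Iset,
        DifferentiableWithinAt ℝ (fun s => pderivT C g s x) (Icc C.T₀ C.Tc) T ∧
        DifferentiableWithinAt ℝ (fun y => pderivT C g T y) (Icc C.eps C.om) x ∧
        DifferentiableWithinAt ℝ (fun s => pderivX C g s x) (Icc C.T₀ C.Tc) T ∧
        DifferentiableWithinAt ℝ (fun y => pderivX C g T y) (Icc C.eps C.om) x) ∧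
    (∀ T ∈ Icc C.T₀ C.Tc, ∀ x ∈ C.Iset,
        pderivX C (pderivT C g) T x = pderivT C (pderivX C g) T x) ∧
    ContinuousOn (fun p : ℝ × ℝ => pderivT C (pderivT C g) p.1 p.2) C.Dset ∧
    ContinuousOn (fun p : ℝ × ℝ => pderivX C (pderivT C g) p.1 p.2) C.Dset ∧
    ContinuousOn (fun p : ℝ × ℝ => pderivX C (pderivX C g) p.1 p.2) C.Dset := by
  have hu := C.uniqueDiffOn_Dset
  set G : ℝ × ℝ → ℝ := fun p => g p.1 p.2 with hG
  set G' := fderivWithin ℝ G C.Dset with hG'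
  set G'' := fderivWithin ℝ G' C.Dset with hG''
  have hd : ∀ p ∈ C.Dset, HasFDerivWithinAt G (G' p) C.Dset p := fun p hp =>
    (hg.differentiableOn two_ne_zero p hp).hasFDerivWithinAt
  have hc' : ContDiffOn ℝ 1 G' C.Dset := hg.fderivWithin hu (by norm_num)
  have hd' : ∀ p ∈ C.Dset, HasFDerivWithinAt G' (G'' p) C.Dset p := fun p hp =>
    (hc'.differentiableOn one_ne_zero p hp).hasFDerivWithinAt
  have hc'' : ContinuousOn G'' C.Dset := hc'.continuousOn_fderivWithin hu le_rfl
  have hT : ∀ p ∈ C.Dset, pderivT C g p.1 p.2 = G' p (1, 0) := fun p hp =>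
    pderivT_eq_of_hasFDerivWithinAt hp.1 hp.2 (hd p hp)
  have hX : ∀ p ∈ C.Dset, pderivX C g p.1 p.2 = G' p (0, 1) := fun p hp =>
    pderivX_eq_of_hasFDerivWithinAt hp.1 hp.2 (hd p hp)
  have hev : ∀ v, ∀ p ∈ C.Dset,
      HasFDerivWithinAt (fun q => G' q v) ((G'' p).flip v) C.Dset p := fun v p hp => by
    simpa using (hd' p hp).clm_apply (hasFDerivWithinAt_const v p C.Dset)
  have hdT : ∀ p ∈ C.Dset, HasFDerivWithinAt (fun q : ℝ × ℝ => pderivT C g q.1 q.2)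
      ((G'' p).flip (1, 0)) C.Dset p := fun p hp => (hev _ p hp).congr hT (hT p hp)
  have hdX : ∀ p ∈ C.Dset, HasFDerivWithinAt (fun q : ℝ × ℝ => pderivX C g q.1 q.2)
      ((G'' p).flip (0, 1)) C.Dset p := fun p hp => (hev _ p hp).congr hX (hX p hp)
  have hcont : ∀ v w, ContinuousOn (fun p => G'' p v w) C.Dset := fun v w =>
    (hc''.clm_apply continuousOn_const).clm_apply continuousOn_const
  refine ⟨fun T hT x hx => ⟨?_, ?_, ?_, ?_⟩, fun T hT x hx => ?_, ?_, ?_, ?_⟩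
  · exact (hasDerivWithinAt_slice_fst hx (hdT (T, x) ⟨hT, hx⟩)).differentiableWithinAt
  · exact (hasDerivWithinAt_slice_snd hT (hdT (T, x) ⟨hT, hx⟩)).differentiableWithinAt
  · exact (hasDerivWithinAt_slice_fst hx (hdX (T, x) ⟨hT, hx⟩)).differentiableWithinAt
  · exact (hasDerivWithinAt_slice_snd hT (hdX (T, x) ⟨hT, hx⟩)).differentiableWithinAt
  · rw [pderivX_eq_of_hasFDerivWithinAt hT hx (hdT (T, x) ⟨hT, hx⟩),
      pderivT_eq_of_hasFDerivWithinAt hT hx (hdX (T, x) ⟨hT, hx⟩)]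
    refine Convex.second_derivative_within_at_symmetric (s := C.Dset)
      ((convex_Icc _ _).prod (convex_Icc _ _)) ?_ (f := G) (f' := G')
      (fun p hp => (hd p (interior_subset hp)).hasFDerivAt (mem_interior_iff_mem_nhds.1 hp))
      (x := (T, x)) ⟨hT, hx⟩ ((hd' (T, x) ⟨hT, hx⟩).mono interior_subset) _ _
    rw [BCSContext.Dset, interior_prod_eq, interior_Icc, interior_Icc]
    exact (nonempty_Ioo.2 C.hT₀₂).prod (nonempty_Ioo.2 C.hepsom)
  · exact (hcont (1, 0) (1, 0)).congr fun p hp =>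
      (pderivT_eq_of_hasFDerivWithinAt hp.1 hp.2 (hdT p hp)).trans rfl
  · exact (hcont (0, 1) (1, 0)).congr fun p hp =>
      (pderivX_eq_of_hasFDerivWithinAt hp.1 hp.2 (hdT p hp)).trans rfl
  · exact (hcont (0, 1) (0, 1)).congr fun p hp =>
      (pderivX_eq_of_hasFDerivWithinAt hp.1 hp.2 (hdX p hp)).trans rfl

/-! ### Regularity of the operator `A` -/

lemma Real.contDiff_tanh {n : WithTop ℕ∞} : ContDiff ℝ n Real.tanh := by
  have : Real.tanh = fun x => Real.sinh x / Real.cosh x := funext Real.tanh_eq_sinh_div_cosh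
  rw [this]
  exact Real.contDiff_sinh.div Real.contDiff_cosh fun x => (Real.cosh_pos x).ne'

/-- The function `(b - t) (∫ V(x, ξ) g(t, ξ) dξ)²` is of class `C²` as soon as `V` is twice, and
`g` and `(b - t) ∂g/∂t` are once continuously differentiable in the first variable. -/
lemma contDiffOn_sub_mul_sq_kernelIntegral {a b c d : ℝ} (hab : a < b) (hcd : c < d)
    {V V₁ V₂ g g₁ k k₁ : ℝ × ℝ → ℝ}
    (hV : HasContPartialFst (Icc c d) (Icc c d) V V₁)
    (hV₁ : HasContPartialFst (Icc c d) (Icc c d) V₁ V₂)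
    (hg : HasContPartialFst (Icc a b) (Icc c d) g g₁)
    (hk : HasContPartialFst (Icc a b) (Icc c d) k k₁)
    (hgk : ∀ p ∈ Icc a b ×ˢ Icc c d, (b - p.1) * g₁ p = k p) :
    ContDiffOn ℝ 2 (fun p => (b - p.1) * kernelIntegral c d V g p ^ 2)
      (Icc a b ×ˢ Icc c d) := by
  have hu : UniqueDiffOn ℝ (Icc a b ×ˢ Icc c d) :=
    (uniqueDiffOn_Icc hab).prod (uniqueDiffOn_Icc hcd)
  have cK := contDiffOn_kernelIntegral isCompact_Icc (convex_Icc a b) hcd.le hu hV hg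
  have cN := contDiffOn_kernelIntegral isCompact_Icc (convex_Icc a b) hcd.le hu hV hk
  have cX := contDiffOn_kernelIntegral isCompact_Icc (convex_Icc a b) hcd.le hu hV₁ hg
  have hN : ∀ p ∈ Icc a b ×ˢ Icc c d,
      (b - p.1) * kernelIntegral c d V g₁ p = kernelIntegral c d V k p := by
    intro p hp
    simp only [kernelIntegral, ← intervalIntegral.integral_const_mul]
    refine intervalIntegral.integral_congr fun ξ hξ => ?_
    rw [uIcc_of_le hcd.le] at hξ
    have := hgk (p.1, ξ) ⟨hp.1, hξ⟩
    simp only at this ⊢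
    rw [← this]
    ring
  have h := contDiffOn_of_hasFDerivWithinAt_prod hu (n := 1)
    (G := fun p => (b - p.1) * kernelIntegral c d V g p ^ 2)
    (A := fun p => -(kernelIntegral c d V g p ^ 2) +
      2 * kernelIntegral c d V g p * kernelIntegral c d V k p)
    (B := fun p => 2 * (b - p.1) * kernelIntegral c d V g p * kernelIntegral c d V₁ g p)
    (by rw [Nat.cast_one]; exact (cK.pow 2).neg.add ((contDiffOn_const.mul cK).mul cN))
    (by
      rw [Nat.cast_one]
      exact ((contDiffOn_const.mul (contDiffOn_const.sub contDiff_fst.contDiffOn)).mul cK).mul cX)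
    (fun p hp => by
      have hK := hasFDerivWithinAt_kernelIntegral isCompact_Icc (convex_Icc a b) hcd.le hV hg hp
      have hs : HasFDerivWithinAt (fun p : ℝ × ℝ => b - p.1) (-ContinuousLinearMap.fst ℝ ℝ ℝ)
          (Icc a b ×ˢ Icc c d) p := hasFDerivWithinAt_fst.const_sub b
      convert! hs.mul (hK.pow 2) using 1
      ext
      · simp [← hN p hp]
        ring
      · simp
        ring)
  simpa [one_add_one_eq_two] using h

/-- The image under the operator `A` of an element of `W` is of class `C²` on `D`. -/
lemma contDiffOn_opA (C : BCSContext) (f : ℝ → ℝ → ℝ) (hf : memW C f) :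
    ContDiffOn ℝ 2 (fun p : ℝ × ℝ => opA C f p.1 p.2) C.Dset := by
  obtain ⟨hfc, -, hzero, -, -, hneg, -⟩ := hf
  have hT₀ : 0 < C.T₀ := C.htau₁pos.trans C.hT₀₁
  set F : ℝ × ℝ → ℝ := fun p => f p.1 p.2 with hF
  obtain ⟨F₁, F₂, hF₁, hF₂⟩ := exists_hasContPartialFst_of_contDiffOn C.uniqueDiffOn_Dset hfc
  have hF₁neg : ∀ p ∈ C.Dset, F₁ p < 0 := by
    rintro ⟨T, x⟩ ⟨hT, hx⟩
    have := hneg T hT x hx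
    rwa [pderivT, (hF₁.hasDeriv T hT x hx).derivWithin (uniqueDiffOn_Icc C.hT₀₂ T hT)] at this
  obtain ⟨h, h₁, hh, hfac, hpos, hh₁⟩ :=
    hF₁.exists_eq_sub_mul C.hT₀₂ isCompact_Icc hF₂ hzero hF₁neg
  have hFnonneg : ∀ p ∈ C.Dset, 0 ≤ F p := fun p hp => by
    rw [hfac p hp]
    exact mul_nonneg (sub_nonneg.2 hp.1.2) (hpos p hp).le
  have hEpos : ∀ p ∈ C.Dset, 0 < p.2 ^ 2 + F p := fun p hp => by
    have := C.heps.trans_le hp.2.1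
    have := hFnonneg p hp
    positivity
  have hΘ : ContDiffOn ℝ 2 (fun p : ℝ × ℝ => Real.tanh (√(p.2 ^ 2 + F p) / (2 * p.1)) /
      √(p.2 ^ 2 + F p)) C.Dset := by
    have hE : ContDiffOn ℝ 2 (fun p : ℝ × ℝ => √(p.2 ^ 2 + F p)) C.Dset :=
      ((contDiff_snd.contDiffOn.pow 2).add hfc).sqrt fun p hp => (hEpos p hp).ne'
    refine ContDiffOn.div (Real.contDiff_tanh.comp_contDiffOn (hE.div
      (contDiffOn_const.mul contDiff_fst.contDiffOn) fun p hp => ?_)) hE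
      fun p hp => (Real.sqrt_pos.2 (hEpos p hp)).ne'
    have := hT₀.trans_le hp.1.1
    positivity
  obtain ⟨Θ₁, Θ₂, hΘ₁, hΘ₂⟩ := exists_hasContPartialFst_of_contDiffOn C.uniqueDiffOn_Dset hΘ
  obtain ⟨V₁, V₂, hV₁, hV₂⟩ := exists_hasContPartialFst_of_contDiffOn
    ((uniqueDiffOn_Icc C.hepsom).prod (uniqueDiffOn_Icc C.hepsom)) C.hUsmooth
  have hsq := hh.sqrt hpos
  have hsqpos : ∀ p ∈ C.Dset, 0 < √(h p) := fun p hp => Real.sqrt_pos.2 (hpos p hp)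
  have hs := HasContPartialFst.const_sub_fst (J := Icc C.T₀ C.Tc) (I := Icc C.eps C.om) C.Tc
  have hhalf : HasContPartialFst (Icc C.T₀ C.Tc) (Icc C.eps C.om) (fun _ => 1 / 2) (fun _ => 0) :=
    ⟨by fun_prop, by fun_prop, fun t _ _ _ => hasDerivWithinAt_const t _ _⟩
  have hk := (((hF₂.add hh).mul (hhalf.mul (hsq.inv fun p hp => (hsqpos p hp).ne'))).mul hΘ₁).add
    ((hs.mul hsq).mul hΘ₂)
  refine (contDiffOn_sub_mul_sq_kernelIntegral C.hT₀₂ C.hepsom hV₁ hV₂ (hsq.mul hΘ₁) hk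
    fun p hp => ?_).congr fun p hp => ?_
  · have := hsqpos p hp
    rw [← hh₁ p hp]
    field_simp
  · have hs0 : 0 ≤ C.Tc - p.1 := sub_nonneg.2 hp.1.2
    rw [opA, ← Real.sq_sqrt hs0, ← mul_pow]
    congr 1
    simp only [kernelIntegral, ← intervalIntegral.integral_const_mul]
    refine intervalIntegral.integral_congr fun ξ hξ => ?_
    rw [uIcc_of_le C.hepsom.le] at hξ
    have hpD : (p.1, ξ) ∈ C.Dset := ⟨hp.1, hξ⟩
    have e1 : √(F (p.1, ξ) / (ξ ^ 2 + F (p.1, ξ))) =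
        √(C.Tc - p.1) * √(h (p.1, ξ)) / √(ξ ^ 2 + F (p.1, ξ)) := by
      rw [Real.sqrt_div (hFnonneg _ hpD), hfac _ hpD, Real.sqrt_mul hs0]
    simp only [hF] at e1 ⊢
    rw [e1]
    ring

theorem stmt_7 (C : BCSContext) (f : ℝ → ℝ → ℝ) (hf : memW C f) :
    (∀ T ∈ Icc C.T₀ C.Tc, ∀ x ∈ C.Iset,
        DifferentiableWithinAt ℝ (fun s => pderivT C (opA C f) s x) (Icc C.T₀ C.Tc) T ∧
        DifferentiableWithinAt ℝ (fun y => pderivT C (opA C f) T y) (Icc C.eps C.om) x ∧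
        DifferentiableWithinAt ℝ (fun s => pderivX C (opA C f) s x) (Icc C.T₀ C.Tc) T ∧
        DifferentiableWithinAt ℝ (fun y => pderivX C (opA C f) T y) (Icc C.eps C.om) x) ∧
    (∀ T ∈ Icc C.T₀ C.Tc, ∀ x ∈ C.Iset,
        pderivX C (pderivT C (opA C f)) T x = pderivT C (pderivX C (opA C f)) T x) ∧
    ContinuousOn (fun p : ℝ × ℝ => pderivT C (pderivT C (opA C f)) p.1 p.2) C.Dset ∧
    ContinuousOn (fun p : ℝ × ℝ => pderivX C (pderivT C (opA C f)) p.1 p.2) C.Dset ∧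
    ContinuousOn (fun p : ℝ × ℝ => pderivX C (pderivX C (opA C f)) p.1 p.2) C.Dset ∧
    ContDiffOn ℝ 2 (fun p : ℝ × ℝ => opA C f p.1 p.2) C.Dset := by
  have h := contDiffOn_opA C f hf
  obtain ⟨h1, h2, h3, h4, h5⟩ := secondOrderPartials_of_contDiffOn C (opA C f) h
  exact ⟨h1, h2, h3, h4, h5, h⟩

end
end

section
/- For every f ∈ W: Af(T_c, x) = 0 for all x ∈ I, and Af(T,x)/Af(T,x₁) ≤ a for all T ∈ [T₀, T_c] and all x, x₁ ∈ I (at T = T_c the ratio being interpreted as (Af)_T(T_c,x)/(Af)_T(T_c,x₁) ≤ a). -/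
open Set MeasureTheory Filter Topology

noncomputable section

theorem Real.tanh_nonneg_of_nonneg {x : ℝ} (hx : 0 ≤ x) : 0 ≤ Real.tanh x := by
  rw [Real.tanh_eq_sinh_div_cosh]
  exact div_nonneg (Real.sinh_nonneg_iff.2 hx) (Real.cosh_pos x).le

theorem Real.continuous_tanh_real : Continuous Real.tanh := by
  have h : Real.tanh = fun x => Real.sinh x / Real.cosh x :=
    funext Real.tanh_eq_sinh_div_cosh
  rw [h]
  exact Real.continuous_sinh.div Real.continuous_cosh fun x => (Real.cosh_pos x).ne'

namespace BCSContext

variable (C : BCSContext)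

theorem T₀_pos : 0 < C.T₀ := C.htau₁pos.trans C.hT₀₁

theorem uIoc_subset_Iset : Set.uIoc C.eps C.om ⊆ Icc C.eps C.om := by
  rw [uIoc_of_le C.hepsom.le]
  exact Ioc_subset_Icc_self

theorem continuousOn_U {x : ℝ} (hx : x ∈ Icc C.eps C.om) :
    ContinuousOn (fun ξ => C.U x ξ) (Icc C.eps C.om) :=
  C.hUsmooth.continuousOn.comp (f := fun ξ : ℝ => (x, ξ)) (by fun_prop) fun _ hξ => ⟨hx, hξ⟩

theorem Umin_le {x ξ : ℝ} (hx : x ∈ Icc C.eps C.om) (hξ : ξ ∈ Icc C.eps C.om) :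
    C.Umin ≤ C.U x ξ :=
  C.hUmin.2 (mem_image2_of_mem hx hξ)

theorem le_Umax {x ξ : ℝ} (hx : x ∈ Icc C.eps C.om) (hξ : ξ ∈ Icc C.eps C.om) :
    C.U x ξ ≤ C.Umax :=
  C.hUmax.2 (mem_image2_of_mem hx hξ)

theorem Umin_pos : 0 < C.Umin := by
  obtain ⟨x, hx, ξ, hξ, h⟩ := C.hUmin.1
  rw [← h]
  exact C.hU₁pos.trans_le (C.hUlb x hx ξ hξ)

theorem Umax_pos : 0 < C.Umax := by
  obtain ⟨x, hx, ξ, hξ, h⟩ := C.hUmax.1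
  rw [← h]
  exact C.hU₁pos.trans_le (C.hUlb x hx ξ hξ)

theorem sq_add_pos {ξ y : ℝ} (hξ : ξ ∈ Icc C.eps C.om) (hy : 0 ≤ y) : 0 < ξ ^ 2 + y := by
  have := C.heps.trans_le hξ.1
  positivity

end BCSContext

namespace memW

variable {C : BCSContext} {f : ℝ → ℝ → ℝ}

theorem nonneg (hf : memW C f) {T ξ : ℝ} (hT : T ∈ Icc C.T₀ C.Tc) (hξ : ξ ∈ Icc C.eps C.om) :
    0 ≤ f T ξ :=
  (sq_nonneg _).trans (hf.2.1 T hT ξ hξ).1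

theorem continuousOn_energy (hf : memW C f) {T : ℝ} (hT : T ∈ Icc C.T₀ C.Tc) :
    ContinuousOn (fun ξ => f T ξ) (Icc C.eps C.om) :=
  hf.1.continuousOn.comp (f := fun ξ : ℝ => (T, ξ)) (by fun_prop) fun _ hξ => ⟨hT, hξ⟩

theorem differentiableOn_temperature (hf : memW C f) {ξ : ℝ} (hξ : ξ ∈ Icc C.eps C.om) :
    DifferentiableOn ℝ (fun s => f s ξ) (Icc C.T₀ C.Tc) :=
  (hf.1.differentiableOn (by norm_num)).comp (f := fun s : ℝ => (s, ξ)) (by fun_prop)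
    fun _ hs => ⟨hs, hξ⟩

/-- Mean value bound for the difference quotient of `f` at the transition temperature. -/
theorem le_MT_mul (hf : memW C f) {T ξ : ℝ} (hT : T ∈ Icc C.T₀ C.Tc)
    (hξ : ξ ∈ Icc C.eps C.om) : f T ξ ≤ C.MT * (C.Tc - T) := by
  have hTc : C.Tc ∈ Icc C.T₀ C.Tc := right_mem_Icc.2 C.hT₀₂.le
  have h := (convex_Icc C.T₀ C.Tc).norm_image_sub_le_of_norm_derivWithin_le
    (hf.differentiableOn_temperature hξ) (C := C.MT) (fun s hs => by
      have h1 : derivWithin (fun s => f s ξ) (Icc C.T₀ C.Tc) s < 0 := hf.2.2.2.2.2.1 s hs ξ hξ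
      have h2 : -derivWithin (fun s => f s ξ) (Icc C.T₀ C.Tc) s ≤ C.MT :=
        hf.2.2.2.2.2.2 s hs ξ hξ
      rwa [Real.norm_eq_abs, abs_of_neg h1]) hTc hT
  rw [hf.2.2.1 ξ hξ, sub_zero, Real.norm_eq_abs, Real.norm_eq_abs, abs_sub_comm T,
    abs_of_nonneg (sub_nonneg.2 hT.2)] at h
  exact (le_abs_self _).trans h

/-- The integrand of `opA`, with the numerator of the square root divided by a constant. -/
theorem continuousOn_integrand (hf : memW C f) {T : ℝ} (hT : T ∈ Icc C.T₀ C.Tc)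
    {u : ℝ → ℝ} (hu : ContinuousOn u (Icc C.eps C.om)) (c : ℝ) :
    ContinuousOn (fun ξ => u ξ * Real.sqrt (f T ξ / c / (ξ ^ 2 + f T ξ)) *
      Real.tanh (Real.sqrt (ξ ^ 2 + f T ξ) / (2 * T))) (Icc C.eps C.om) := by
  have hfT := hf.continuousOn_energy hT
  have hsum : ContinuousOn (fun ξ => ξ ^ 2 + f T ξ) (Icc C.eps C.om) := by fun_prop
  refine (hu.mul (Real.continuous_sqrt.comp_continuousOn
    ((hfT.div_const c).div hsum fun ξ hξ => (C.sq_add_pos hξ (hf.nonneg hT hξ)).ne'))).mul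
    (Real.continuous_tanh_real.comp_continuousOn ?_)
  exact (Real.continuous_sqrt.comp_continuousOn hsum).div_const _

theorem opA_Tc (hf : memW C f) (x : ℝ) : opA C f C.Tc x = 0 := by
  have h : ∀ ξ ∈ Set.uIcc C.eps C.om, C.U x ξ * Real.sqrt (f C.Tc ξ / (ξ ^ 2 + f C.Tc ξ)) *
      Real.tanh (Real.sqrt (ξ ^ 2 + f C.Tc ξ) / (2 * C.Tc)) = 0 := fun ξ hξ => by
    rw [uIcc_of_le C.hepsom.le] at hξ
    simp [hf.2.2.1 ξ hξ]
  rw [opA, intervalIntegral.integral_congr (g := fun _ => 0) h]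
  simp

theorem opA_le_mul_opA (hf : memW C f) {T x x₁ : ℝ} (hT : T ∈ Icc C.T₀ C.Tc)
    (hx : x ∈ Icc C.eps C.om) (hx₁ : x₁ ∈ Icc C.eps C.om) :
    opA C f T x ≤ C.a * opA C f T x₁ := by
  set k : ℝ → ℝ := fun ξ => Real.sqrt (f T ξ / (ξ ^ 2 + f T ξ)) *
    Real.tanh (Real.sqrt (ξ ^ 2 + f T ξ) / (2 * T)) with hk
  have hk0 : ∀ ξ, 0 ≤ k ξ := fun ξ => by
    have := C.T₀_pos.trans_le hT.1
    exact mul_nonneg (Real.sqrt_nonneg _) (Real.tanh_nonneg_of_nonneg (by positivity))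
  have hint : ∀ u : ℝ → ℝ, ContinuousOn u (Icc C.eps C.om) →
      IntervalIntegrable (fun ξ => u ξ * k ξ) volume C.eps C.om := fun u hu => by
    have h := (hf.continuousOn_integrand hT hu 1).intervalIntegrable_of_Icc
      (μ := volume) C.hepsom.le
    simpa only [div_one, mul_assoc] using h
  have hop : ∀ y, opA C f T y = (∫ ξ in C.eps..C.om, C.U y ξ * k ξ) ^ 2 := fun y => by
    simp only [opA, hk, mul_assoc]
  have hupper : ∫ ξ in C.eps..C.om, C.U x ξ * k ξ ≤ C.Umax * ∫ ξ in C.eps..C.om, k ξ := by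
    rw [← intervalIntegral.integral_const_mul]
    exact intervalIntegral.integral_mono_on C.hepsom.le (hint _ (C.continuousOn_U hx))
      (hint _ continuousOn_const) fun ξ hξ =>
        mul_le_mul_of_nonneg_right (C.le_Umax hx hξ) (hk0 ξ)
  have hlower : C.Umin * ∫ ξ in C.eps..C.om, k ξ ≤ ∫ ξ in C.eps..C.om, C.U x₁ ξ * k ξ := by
    rw [← intervalIntegral.integral_const_mul]
    exact intervalIntegral.integral_mono_on C.hepsom.le (hint _ continuousOn_const)
      (hint _ (C.continuousOn_U hx₁)) fun ξ hξ =>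
        mul_le_mul_of_nonneg_right (C.Umin_le hx₁ hξ) (hk0 ξ)
  have hpos : 0 ≤ ∫ ξ in C.eps..C.om, C.U x ξ * k ξ :=
    intervalIntegral.integral_nonneg C.hepsom.le fun ξ hξ =>
      mul_nonneg (C.hU₁pos.le.trans (C.hUlb x hx ξ hξ)) (hk0 ξ)
  have hK : 0 ≤ ∫ ξ in C.eps..C.om, k ξ :=
    intervalIntegral.integral_nonneg C.hepsom.le fun ξ _ => hk0 ξ
  have hm := C.Umin_pos
  rw [hop, hop, C.ha, ← mul_pow]
  refine pow_le_pow_left₀ hpos (hupper.trans ?_) 2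
  have hM := C.Umax_pos
  calc C.Umax * ∫ ξ in C.eps..C.om, k ξ
      = C.Umax / C.Umin * (C.Umin * ∫ ξ in C.eps..C.om, k ξ) := by field_simp
    _ ≤ _ := by gcongr

theorem differentiableWithinAt_opA (hf : memW C f) {x : ℝ} (hx : x ∈ Icc C.eps C.om) :
    DifferentiableWithinAt ℝ (fun s => opA C f s x) (Icc C.T₀ C.Tc) C.Tc := by
  have hTc : C.Tc ∈ Icc C.T₀ C.Tc := right_mem_Icc.2 C.hT₀₂.le
  have hTcpos : 0 < C.Tc := C.T₀_pos.trans C.hT₀₂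
  set d : ℝ → ℝ := fun ξ => derivWithin (fun s => f s ξ) (Icc C.T₀ C.Tc) C.Tc with hd
  set l : Filter ℝ := 𝓝[Icc C.T₀ C.Tc \ {C.Tc}] C.Tc with hl
  have hmem : ∀ᶠ T in l, T ∈ Icc C.T₀ C.Tc \ {C.Tc} := self_mem_nhdsWithin
  have hlt : ∀ {T}, T ∈ Icc C.T₀ C.Tc \ {C.Tc} → 0 < C.Tc - T := fun hT =>
    sub_pos.2 (lt_of_le_of_ne hT.1.2 hT.2)
  have hid : Tendsto (fun T => T) l (𝓝 C.Tc) := tendsto_nhdsWithin_of_tendsto_nhds tendsto_id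
  set F : ℝ → ℝ → ℝ := fun T ξ => C.U x ξ * Real.sqrt (f T ξ / (C.Tc - T) / (ξ ^ 2 + f T ξ)) *
    Real.tanh (Real.sqrt (ξ ^ 2 + f T ξ) / (2 * T)) with hF
  have hlim : Tendsto (fun T => ∫ ξ in C.eps..C.om, F T ξ) l
      (𝓝 (∫ ξ in C.eps..C.om, C.U x ξ * Real.sqrt (-d ξ / (ξ ^ 2 + 0)) *
        Real.tanh (Real.sqrt (ξ ^ 2 + 0) / (2 * C.Tc)))) := by
    refine intervalIntegral.tendsto_integral_filter_of_dominated_convergence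
      (fun _ => C.U₂ * Real.sqrt (C.MT / C.eps ^ 2) * 1) ?_ ?_ intervalIntegrable_const ?_
    · filter_upwards [hmem] with T hT
      exact ((hf.continuousOn_integrand hT.1 (C.continuousOn_U hx) _).mono
        C.uIoc_subset_Iset).aestronglyMeasurable measurableSet_uIoc
    · filter_upwards [hmem] with T hT
      refine ae_of_all _ fun ξ hξ => ?_
      have hξ' := C.uIoc_subset_Iset hξ
      have hf0 := hf.nonneg hT.1 hξ'
      have hfM : f T ξ / (C.Tc - T) ≤ C.MT :=
        (div_le_iff₀ (hlt hT)).2 (hf.le_MT_mul hT.1 hξ')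
      have hM : 0 ≤ C.MT := (div_nonneg hf0 (hlt hT).le).trans hfM
      have hU : 0 ≤ C.U x ξ := C.hU₁pos.le.trans (C.hUlb x hx ξ hξ')
      have heps := C.heps
      rw [hF, Real.norm_eq_abs, abs_mul, abs_mul, abs_of_nonneg hU,
        abs_of_nonneg (Real.sqrt_nonneg _)]
      have hsq : C.eps ^ 2 ≤ ξ ^ 2 + f T ξ := by nlinarith [hξ'.1]
      gcongr
      · exact mul_nonneg (hU.trans (C.hUub x hx ξ hξ')) (Real.sqrt_nonneg _)
      · exact hU.trans (C.hUub x hx ξ hξ')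
      · exact C.hUub x hx ξ hξ'
      · exact (Real.abs_tanh_lt_one _).le
    · refine ae_of_all _ fun ξ hξ => ?_
      have hξ' := C.uIoc_subset_Iset hξ
      have hdiff := hf.differentiableOn_temperature hξ' C.Tc hTc
      have hslope : Tendsto (fun T => f T ξ / (C.Tc - T)) l (𝓝 (-d ξ)) := by
        refine ((hasDerivWithinAt_iff_tendsto_slope.1 hdiff.hasDerivWithinAt).neg).congr fun T => ?_
        rw [slope_def_field, hf.2.2.1 ξ hξ', sub_zero, ← div_neg, neg_sub]
      have hf0 : Tendsto (fun T => f T ξ) l (𝓝 0) := by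
        have h := hdiff.continuousWithinAt.tendsto
        rw [hf.2.2.1 ξ hξ'] at h
        exact h.mono_left (nhdsWithin_mono _ sdiff_subset)
      have hsum : Tendsto (fun T => ξ ^ 2 + f T ξ) l (𝓝 (ξ ^ 2 + 0)) := hf0.const_add _
      refine (((hslope.div hsum (C.sq_add_pos hξ' le_rfl).ne').sqrt).const_mul _).mul
        ((Real.continuous_tanh_real.tendsto _).comp (hsum.sqrt.div (hid.const_mul 2) ?_))
      positivity
  refine (hasDerivWithinAt_iff_tendsto_slope.2 ((hlim.pow 2).neg.congr' ?_)).differentiableWithinAt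
  filter_upwards [hmem] with T hT
  have hδ := hlt hT
  have hscale : ∫ ξ in C.eps..C.om, C.U x ξ * Real.sqrt (f T ξ / (ξ ^ 2 + f T ξ)) *
      Real.tanh (Real.sqrt (ξ ^ 2 + f T ξ) / (2 * T)) =
      Real.sqrt (C.Tc - T) * ∫ ξ in C.eps..C.om, F T ξ := by
    rw [← intervalIntegral.integral_const_mul]
    refine intervalIntegral.integral_congr fun ξ _ => ?_
    have h : f T ξ / (ξ ^ 2 + f T ξ) =
        (C.Tc - T) * (f T ξ / (C.Tc - T) / (ξ ^ 2 + f T ξ)) := by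
      rw [← mul_div_assoc, mul_div_cancel₀ _ hδ.ne']
    simp only [hF]
    rw [h, Real.sqrt_mul hδ.le]
    ring
  rw [slope_def_field, hf.opA_Tc, opA, hscale, mul_pow, Real.sq_sqrt hδ.le, sub_zero,
    ← neg_sub C.Tc T, div_neg, mul_div_cancel_left₀ _ hδ.ne']

theorem neg_pderivT_opA_le (hf : memW C f) {x x₁ : ℝ} (hx : x ∈ Icc C.eps C.om)
    (hx₁ : x₁ ∈ Icc C.eps C.om) :
    -(pderivT C (opA C f) C.Tc x) ≤ C.a * -(pderivT C (opA C f) C.Tc x₁) := by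
  have h := ((hf.differentiableWithinAt_opA hx₁).hasDerivWithinAt.const_mul C.a).sub
    (hf.differentiableWithinAt_opA hx).hasDerivWithinAt
  rw [hasDerivWithinAt_iff_tendsto_slope, Icc_sdiff_right, nhdsWithin_Ico_eq_nhdsLT C.hT₀₂] at h
  have hle := le_of_tendsto h (b := 0) (by
    filter_upwards [Ico_mem_nhdsLT C.hT₀₂] with T hT
    have hT' := hf.opA_le_mul_opA (Ico_subset_Icc_self hT) hx hx₁
    rw [slope_def_field]
    simp only [Pi.sub_apply, hf.opA_Tc]
    exact div_nonpos_of_nonneg_of_nonpos (by linarith) (by linarith [hT.2]))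
  simp only [pderivT]
  linarith

end memW

theorem stmt_9 (C : BCSContext) (f : ℝ → ℝ → ℝ) (hf : memW C f) :
    (∀ x ∈ C.Iset, opA C f C.Tc x = 0) ∧
    (∀ T ∈ Ico C.T₀ C.Tc, ∀ x ∈ C.Iset, ∀ x₁ ∈ C.Iset,
        opA C f T x ≤ C.a * opA C f T x₁) ∧
    (∀ x ∈ C.Iset, ∀ x₁ ∈ C.Iset,
        -(pderivT C (opA C f) C.Tc x) ≤ C.a * -(pderivT C (opA C f) C.Tc x₁)) := by
  exact ⟨fun x _ => hf.opA_Tc x,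
    fun T hT x hx x₁ hx₁ => hf.opA_le_mul_opA (Ico_subset_Icc_self hT) hx hx₁,
    fun x hx x₁ hx₁ => hf.neg_pderivT_opA_le hx hx₁⟩

end
end
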